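/- arXiv:1210.2579 — 2 statements merged into one kernel-verified Lean document; each statement's English description precedes it below -/
import Mathlib

section
/- Let M be the 3×3 matrix with zero diagonal and off-diagonal entries 1/2, and W₃ the 3×3 matrix with all entries 1/3. If k > 2/3, then kM + (1−k)W₃ is not in the convex hull of the 3×3 H-unistochastic matrices. -/
open Matrix BigOperators

/-- The set of n×n H-unistochastic matrices. -/
def HUnistochastic (n : ℕ) : Set (Matrix (Fin n) (Fin n) ℝ) :=
  {M | ∃ U : Matrix (Fin n) (Fin n) ℂ, Uᴴ = U ∧ U * U = 1 ∧
    ∀ i j, M i j = ‖U i j‖ ^ 2}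

theorem trace_ge_aux (M : Matrix (Fin 3) (Fin 3) ℝ) (hM : M ∈ HUnistochastic 3) :
    1 / 3 ≤ M 0 0 + M 1 1 + M 2 2 := by
  obtain ⟨U, -, hU, hN⟩ := hM
  have hd : U.det * U.det = 1 := by rw [← Matrix.det_mul, hU, Matrix.det_one]
  have hadj : U.adjugate = U.det • U := by
    calc U.adjugate = U.adjugate * (U * U) := by rw [hU, mul_one]
      _ = U.det • U := by
        rw [← mul_assoc, Matrix.adjugate_mul, Matrix.smul_mul, one_mul]
  have ha : ∀ i, U.adjugate i i = U.det * U i i := fun i => by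
    rw [hadj]; simp
  have hs : ∀ i, U i 0 * U 0 i + U i 1 * U 1 i + U i 2 * U 2 i = 1 := fun i => by
    have := congrFun (congrFun hU i) i
    rw [Matrix.mul_apply, Fin.sum_univ_three, Matrix.one_apply_eq] at this
    exact this
  have a0 := ha 0
  have a1 := ha 1
  have a2 := ha 2
  have s0 := hs 0
  have s1 := hs 1
  have s2 := hs 2
  generalize U.det = d at *
  rw [Matrix.adjugate_fin_three] at a0 a1 a2
  simp at a0 a1 a2
  have key : (U 0 0 + U 1 1 + U 2 2 - 3 * d) * (U 0 0 + U 1 1 + U 2 2 + d) = 0 := by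
    linear_combination s0 + s1 + s2 + 2 * (a0 + a1 + a2) - 3 * hd
  have hre : 1 ≤ ((U 0 0).re + (U 1 1).re + (U 2 2).re) ^ 2 := by
    have e : (U 0 0).re + (U 1 1).re + (U 2 2).re = (U 0 0 + U 1 1 + U 2 2).re := by simp
    rw [e]
    rcases mul_self_eq_one_iff.mp hd with rfl | rfl <;> rcases mul_eq_zero.mp key with h | h
    · rw [sub_eq_zero.mp h]; norm_num
    · rw [eq_neg_of_add_eq_zero_left h]; norm_num
    · rw [sub_eq_zero.mp h]; norm_num
    · rw [eq_neg_of_add_eq_zero_left h]; norm_num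
  have hn : ∀ z : ℂ, z.re ^ 2 ≤ ‖z‖ ^ 2 := fun z => by
    rw [Complex.sq_norm, Complex.normSq_apply]; nlinarith [mul_self_nonneg z.im]
  rw [hN, hN, hN]
  nlinarith [hn (U 0 0), hn (U 1 1), hn (U 2 2), sq_nonneg ((U 0 0).re - (U 1 1).re),
    sq_nonneg ((U 0 0).re - (U 2 2).re), sq_nonneg ((U 1 1).re - (U 2 2).re)]

/-- For k > 2/3, kB₃ + (1-k)W₃ is not in the convex hull of the
3×3 H-unistochastic matrices. -/
theorem not_in_hull_of_gt_two_thirds (k : ℝ) (hk : 2 / 3 < k) :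
    (fun i j : Fin 3 =>
        k * (if i = j then (0 : ℝ) else 1 / 2) + (1 - k) * (1 / 3)) ∉
      convexHull ℝ (HUnistochastic 3) := by
  intro h
  have hc : Convex ℝ {M : Matrix (Fin 3) (Fin 3) ℝ | 1 / 3 ≤ M 0 0 + M 1 1 + M 2 2} := by
    intro A hA B hB a b ha hb hab
    simp only [Set.mem_ofPred_eq, Matrix.add_apply, Matrix.smul_apply, smul_eq_mul] at *
    nlinarith [mul_le_mul_of_nonneg_left hA ha, mul_le_mul_of_nonneg_left hB hb]
  have h2 := convexHull_min (t := {M : Matrix (Fin 3) (Fin 3) ℝ | 1 / 3 ≤ M 0 0 + M 1 1 + M 2 2})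
    (fun M hM => trace_ge_aux M hM) hc h
  have h3 : (1 / 3 : ℝ) ≤ (k * 0 + (1 - k) * (1 / 3)) + (k * 0 + (1 - k) * (1 / 3)) +
      (k * 0 + (1 - k) * (1 / 3)) := by
    have h4 := Set.mem_ofPred.mp h2
    simpa only [if_true] using h4
  linarith
end

section
/- A completely positive trace-preserving linear map Φ: M₂(ℂ) → M₂(ℂ) that is unital and self-dual admits a decomposition Φ(A) = Σᵢ pᵢ RᵢARᵢ where each Rᵢ is a 2×2 Hermitian unitary matrix, pᵢ > 0, and Σᵢ pᵢ = 1. -/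
open Matrix BigOperators

/-- Discard zero weights and reindex by `Fin m`. -/
lemma sdls_reindex {ι : Type} [Fintype ι] (p : ι → ℝ) (R : ι → Matrix (Fin 2) (Fin 2) ℂ)
    (Φ : Matrix (Fin 2) (Fin 2) ℂ → Matrix (Fin 2) (Fin 2) ℂ)
    (hp : ∀ k, 0 ≤ p k) (hs : ∑ k, p k = 1)
    (hR : ∀ k, (R k)ᴴ = R k ∧ R k * R k = 1)
    (h : ∀ A, Φ A = ∑ k, (p k : ℂ) • (R k * A * R k)) :
    ∃ (m : ℕ) (p : Fin m → ℝ) (R : Fin m → Matrix (Fin 2) (Fin 2) ℂ),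
      (∀ k, 0 < p k) ∧ (∑ k, p k = 1) ∧
      (∀ k, (R k)ᴴ = R k ∧ R k * R k = 1) ∧
      ∀ A, Φ A = ∑ k, (p k : ℂ) • (R k * A * R k) := by
  classical
  let S : Type := {k : ι // p k ≠ 0}
  let e : Fin (Fintype.card S) ≃ S := (Fintype.equivFin S).symm
  refine ⟨Fintype.card S, fun k => p (e k).1, fun k => R (e k).1, ?_, ?_, ?_, ?_⟩
  · intro k
    exact lt_of_le_of_ne (hp _) (Ne.symm (e k).2)
  · rw [e.sum_comp (fun s : S => p s.1), ← hs]
    refine Fintype.sum_of_injective (fun s : S => s.1) Subtype.val_injective _ _ ?_ fun _ => rfl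
    intro k hk
    by_contra hne
    exact hk ⟨⟨k, hne⟩, rfl⟩
  · intro k
    exact hR _
  · intro A
    rw [h, e.sum_comp (fun s : S => (p s.1 : ℂ) • (R s.1 * A * R s.1))]
    symm
    refine Fintype.sum_of_injective (fun s : S => s.1) Subtype.val_injective _ _ ?_ fun _ => rfl
    intro k hk
    have h0 : p k = 0 := by
      by_contra hne
      exact hk ⟨⟨k, hne⟩, rfl⟩
    simp [h0]

/-- A Hermitian 2×2 matrix splits as a scalar plus a multiple of a Hermitian unitary. -/
lemma sdls_split (H : Matrix (Fin 2) (Fin 2) ℂ) (hH : Hᴴ = H) :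
    ∃ (t s : ℝ) (R : Matrix (Fin 2) (Fin 2) ℂ), Rᴴ = R ∧ R * R = 1 ∧ (s : ℂ) * R.trace = 0 ∧
      H = (t : ℂ) • (1 : Matrix (Fin 2) (Fin 2) ℂ) + (s : ℂ) • R := by
  have h00 : star (H 0 0) = H 0 0 := congrFun (congrFun hH 0) 0
  have h11 : star (H 1 1) = H 1 1 := congrFun (congrFun hH 1) 1
  have h01 : star (H 1 0) = H 0 1 := congrFun (congrFun hH 0) 1
  obtain ⟨a, ha⟩ : ∃ a : ℝ, H 0 0 = a := ⟨_, (Complex.conj_eq_iff_re.1 h00).symm⟩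
  obtain ⟨d, hd⟩ : ∃ d : ℝ, H 1 1 = d := ⟨_, (Complex.conj_eq_iff_re.1 h11).symm⟩
  obtain ⟨z, hz⟩ : ∃ z : ℂ, H 1 0 = z := ⟨_, rfl⟩
  rw [hz] at h01
  set g : ℝ := (a - d) / 2 with hg
  set q : ℝ := g ^ 2 + Complex.normSq z with hq
  have hn := Complex.normSq_nonneg z
  have hq0 : 0 ≤ q := by positivity
  have hHe : H = !![(a : ℂ), star z; z, (d : ℂ)] := by
    ext i j
    fin_cases i <;> fin_cases j <;> simp [ha, hd, hz, ← h01]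
  by_cases h0 : q = 0
  · have hg0 : g = 0 := by nlinarith [sq_nonneg g]
    have hz0 : z = 0 := by
      apply Complex.normSq_eq_zero.1
      nlinarith [sq_nonneg g]
    refine ⟨a, 0, 1, by simp, by simp, by simp, ?_⟩
    have had : a = d := by linarith
    rw [hHe, hz0, had]
    ext i j
    fin_cases i <;> fin_cases j <;> simp
  · have hs : Real.sqrt q ^ 2 = q := Real.sq_sqrt hq0
    have hs0 : Real.sqrt q ≠ 0 := by
      intro h
      rw [h] at hs
      apply h0
      rw [← hs]; norm_num
    set s := Real.sqrt q
    have hsc : (s : ℂ) ≠ 0 := by exact_mod_cast hs0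
    have key : (g : ℂ) ^ 2 + star z * z = (s : ℂ) ^ 2 := by
      have h1 : star z * z = ((Complex.normSq z : ℝ) : ℂ) := by
        rw [mul_comm]; exact Complex.mul_conj z
      rw [h1]
      exact_mod_cast (hs.trans hq).symm
    refine ⟨(a + d) / 2, s, (s : ℂ)⁻¹ • !![(g : ℂ), star z; z, -(g : ℂ)], ?_, ?_, ?_, ?_⟩
    · ext i j
      fin_cases i <;> fin_cases j <;> simp [Matrix.conjTranspose_apply]
    · rw [Matrix.smul_mul, Matrix.mul_smul, smul_smul]
      have : !![(g : ℂ), star z; z, -(g : ℂ)] * !![(g : ℂ), star z; z, -(g : ℂ)]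
          = ((s : ℂ) ^ 2) • (1 : Matrix (Fin 2) (Fin 2) ℂ) := by
        rw [← key]
        ext i j
        fin_cases i <;> fin_cases j <;> simp [Matrix.mul_apply, Fin.sum_univ_two] <;> ring
      rw [this, smul_smul]
      have : (s : ℂ)⁻¹ * (s : ℂ)⁻¹ * (s : ℂ) ^ 2 = 1 := by field_simp
      rw [this, one_smul]
    · simp [Matrix.trace_fin_two]
    · rw [smul_smul, mul_inv_cancel₀ hsc, one_smul, hHe, hg]
      ext i j
      fin_cases i <;> fin_cases j <;> simp <;> ring

/-- A unital map of the form `∑ H A H` with Hermitian `H` is a mixed Hermitian unitary map. -/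
lemma sdls_herm {ι : Type} [Fintype ι] (H : ι → Matrix (Fin 2) (Fin 2) ℂ)
    (hH : ∀ i, (H i)ᴴ = H i) (hU : ∑ i, H i * H i = 1)
    (Φ : Matrix (Fin 2) (Fin 2) ℂ → Matrix (Fin 2) (Fin 2) ℂ)
    (h : ∀ A, Φ A = ∑ i, H i * A * H i) :
    ∃ (m : ℕ) (p : Fin m → ℝ) (R : Fin m → Matrix (Fin 2) (Fin 2) ℂ),
      (∀ k, 0 < p k) ∧ (∑ k, p k = 1) ∧
      (∀ k, (R k)ᴴ = R k ∧ R k * R k = 1) ∧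
      ∀ A, Φ A = ∑ k, (p k : ℂ) • (R k * A * R k) := by
  choose t s R hR1 hR2 hR3 hsp using fun i => sdls_split (H i) (hH i)
  set K : Matrix (Fin 2) (Fin 2) ℂ := ∑ i, ((t i : ℂ) * s i) • R i with hK
  have hexp : ∀ A, ∑ i, H i * A * H i = ((∑ i, (t i : ℂ) ^ 2) • A
      + ∑ i, ((s i : ℂ) ^ 2) • (R i * A * R i)) + (K * A + A * K) := by
    intro A
    rw [hK, Finset.sum_mul, Finset.mul_sum, Finset.sum_smul, ← Finset.sum_add_distrib,
      ← Finset.sum_add_distrib, ← Finset.sum_add_distrib]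
    refine Finset.sum_congr rfl fun i _ => ?_
    rw [hsp i]
    simp only [Matrix.add_mul, Matrix.mul_add, Matrix.smul_mul, Matrix.mul_smul, Matrix.one_mul,
      Matrix.mul_one]
    module
  have hKtr : K.trace = 0 := by
    rw [hK, Matrix.trace_sum]
    refine Finset.sum_eq_zero fun i _ => ?_
    rw [Matrix.trace_smul, smul_eq_mul, mul_assoc, hR3, mul_zero]
  have h1 := hexp 1
  simp only [Matrix.mul_one, Matrix.one_mul, hR2, hU] at h1
  rw [← Finset.sum_smul, ← add_smul, ← two_smul ℂ K] at h1
  have hsum : (∑ i, (t i : ℂ) ^ 2) + ∑ i, (s i : ℂ) ^ 2 = 1 := by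
    have := congrArg Matrix.trace h1
    simp only [Matrix.trace_add, Matrix.trace_smul, hKtr, Matrix.trace_one, smul_eq_mul] at this
    simp at this
    exact this
  have hK0 : K = 0 := by
    rw [hsum, one_smul] at h1
    have h2 : (2 : ℂ) • K = 0 := by simpa using h1
    exact (smul_eq_zero.1 h2).resolve_left two_ne_zero
  refine sdls_reindex (ι := Option ι) (fun o => o.elim (∑ i, t i ^ 2) fun i => s i ^ 2)
    (fun o => o.elim 1 R) Φ ?_ ?_ ?_ ?_
  · rintro (_ | i)
    · exact Finset.sum_nonneg fun i _ => sq_nonneg _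
    · exact sq_nonneg _
  · rw [Fintype.sum_option]
    exact_mod_cast hsum
  · rintro (_ | i)
    · simp
    · exact ⟨hR1 i, hR2 i⟩
  · intro A
    rw [h, hexp, hK0, Fintype.sum_option]
    simp

/-- self-dual Landau–Streater theorem: every self-dual doubly
stochastic map on M₂(ℂ) is a mixed Hermitian unitary map. -/
theorem selfDual_landau_streater
    (Φ : Matrix (Fin 2) (Fin 2) ℂ →ₗ[ℂ] Matrix (Fin 2) (Fin 2) ℂ)
    (hCP : ∃ (r : ℕ) (V : Fin r → Matrix (Fin 2) (Fin 2) ℂ),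
      ∀ A, Φ A = ∑ i, V i * A * (V i)ᴴ)
    (hUnital : Φ 1 = 1)
    (hTrace : ∀ A, (Φ A).trace = A.trace)
    (hSelfDual : ∀ A B : Matrix (Fin 2) (Fin 2) ℂ,
      (Φ A * Bᴴ).trace = (A * (Φ B)ᴴ).trace) :
    ∃ (m : ℕ) (p : Fin m → ℝ) (R : Fin m → Matrix (Fin 2) (Fin 2) ℂ),
      (∀ k, 0 < p k) ∧ (∑ k, p k = 1) ∧
      (∀ k, (R k)ᴴ = R k ∧ R k * R k = 1) ∧
      ∀ A, Φ A = ∑ k, (p k : ℂ) • (R k * A * R k) := by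
  obtain ⟨r, V, hV⟩ := hCP
  have hV' : ∀ A, Φ A = ∑ i, (V i)ᴴ * A * V i := by
    intro A
    rw [Matrix.ext_iff_trace_mul_right]
    intro B
    have := hSelfDual A Bᴴ
    rw [Matrix.conjTranspose_conjTranspose] at this
    rw [this, hV, Matrix.conjTranspose_sum, Finset.mul_sum, Finset.sum_mul, Matrix.trace_sum,
      Matrix.trace_sum]
    refine Finset.sum_congr rfl fun i _ => ?_
    simp only [Matrix.conjTranspose_mul, Matrix.conjTranspose_conjTranspose]
    rw [Matrix.mul_assoc (V i)ᴴ, Matrix.mul_assoc (V i)ᴴ, Matrix.trace_mul_comm (V i)ᴴ]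
    simp only [Matrix.mul_assoc]
  let H : Fin r ⊕ Fin r → Matrix (Fin 2) (Fin 2) ℂ := Sum.elim
    (fun i => (1 / 2 : ℂ) • (V i + (V i)ᴴ)) (fun i => (Complex.I / 2) • (V i - (V i)ᴴ))
  have hH : ∀ i, (H i)ᴴ = H i := by
    rintro (i | i)
    · simp [H, Matrix.conjTranspose_smul, add_comm]
    · simp only [H, Sum.elim_inr, Matrix.conjTranspose_smul, Matrix.conjTranspose_sub,
        Matrix.conjTranspose_conjTranspose]
      have : star (Complex.I / 2) = -(Complex.I / 2) := by simp [neg_div]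
      rw [this]
      module
  have hΦ : ∀ A, Φ A = ∑ i, H i * A * H i := by
    intro A
    have h2 : Φ A = (1 / 2 : ℂ) • (Φ A + Φ A) := by module
    rw [h2]
    nth_rewrite 1 [hV A]
    rw [hV' A, Fintype.sum_sum_type, ← Finset.sum_add_distrib, ← Finset.sum_add_distrib,
      Finset.smul_sum]
    refine Finset.sum_congr rfl fun i _ => ?_
    have hI : Complex.I / 2 * (Complex.I / 2) = -(1 / 4) := by
      linear_combination (1 / 4 : ℂ) * Complex.I_mul_I
    simp only [H, Sum.elim_inl, Sum.elim_inr, Matrix.smul_mul, Matrix.mul_smul, smul_add, smul_sub, smul_smul, hI,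
      Matrix.add_mul, Matrix.mul_add, Matrix.sub_mul, Matrix.mul_sub]
    module
  refine sdls_herm H hH ?_ Φ hΦ
  have := hΦ 1
  rw [hUnital] at this
  simpa using this.symm
end
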